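/- Under hypothesis (H1), h_top(g) = h_top(f), and any weak* accumulation point ν of the sequence (ν_n) is a measure of maximal entropy for g: h_ν(g) = h_top(g). -/

import Mathlib

open MeasureTheory Filter Topology Set
open scoped ENNReal NNReal

namespace Samva

variable {X : Type*}

/-- The `n`-th iterate (`n : ℤ`) of a homeomorphism. -/
noncomputable def zIter [TopologicalSpace X] (f : X ≃ₜ X) : ℤ → X → X
  | Int.ofNat n => (f : X → X)^[n]
  | Int.negSucc n => (f.symm : X → X)^[n + 1]

/-- `f` is expansive with expansivity constant `α`. -/
def IsExpansiveWith [PseudoMetricSpace X] (f : X ≃ₜ X) (α : ℝ) : Prop :=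
  0 < α ∧ ∀ x y : X, (∀ n : ℤ, dist (zIter f n x) (zIter f n y) ≤ α) → x = y

/-- `f` is expansive. -/
def IsExpansive [PseudoMetricSpace X] (f : X ≃ₜ X) : Prop :=
  ∃ α : ℝ, IsExpansiveWith f α

/-- The (periodic) specification property. -/
def HasSpecification [PseudoMetricSpace X] (f : X ≃ₜ X) : Prop :=
  ∀ ε : ℝ, 0 < ε → ∃ M : ℕ, ∀ (k : ℕ) (x : Fin (k + 1) → X) (a b : Fin (k + 1) → ℤ),
    (∀ i, a i ≤ b i) →
    (∀ i : Fin k, (M : ℤ) ≤ a i.succ - b i.castSucc) →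
    ∀ p : ℤ, (M : ℤ) + b (Fin.last k) - a 0 ≤ p →
      ∃ z : X, zIter f p z = z ∧
        ∀ i, ∀ j : ℤ, a i ≤ j → j ≤ b i → dist (zIter f j z) (zIter f j (x i)) ≤ ε

/-- The set of `n`-periodic points. -/
def perSet (f : X → X) (n : ℕ) : Set X := {x | f^[n] x = x}

/-- The uniform (equidistributed) probability measure on the `n`-periodic points of `f`,
`μ_n = |Per_n(f)|⁻¹ ∑_{x ∈ Per_n(f)} δ_x`. -/
noncomputable def perMeasure [MeasurableSpace X] (f : X → X) (n : ℕ) : Measure X :=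
  ProbabilityTheory.uniformOn (perSet f n)

/-- The uniform probability measure on a set `s`,
`|s|⁻¹ ∑_{x ∈ s} δ_x`. -/
noncomputable def unifMeasure [MeasurableSpace X] (s : Set X) : Measure X :=
  ProbabilityTheory.uniformOn s

/-- Weak* convergence of a sequence of measures against continuous test functions. -/
def WeakLimit [TopologicalSpace X] [MeasurableSpace X] (μs : ℕ → Measure X) (ν : Measure X) :
    Prop :=
  ∀ φ : C(X, ℝ), Tendsto (fun n => ∫ x, φ x ∂(μs n)) atTop (𝓝 (∫ x, φ x ∂ν))

/-- `ν` is a weak* accumulation point of the sequence `μs`. -/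
def WeakClusterPt [TopologicalSpace X] [MeasurableSpace X] (μs : ℕ → Measure X)
    (ν : Measure X) : Prop :=
  ∃ u : ℕ → ℕ, StrictMono u ∧ WeakLimit (μs ∘ u) ν

/-- `E` is `(n,ε)`-separated for `g`. -/
def IsSep [PseudoMetricSpace X] (g : X → X) (n : ℕ) (ε : ℝ) (E : Set X) : Prop :=
  E.Pairwise fun x y => ∃ j < n, ε < dist (g^[j] x) (g^[j] y)

/-- Maximal cardinality of an `(n,ε)`-separated subset of `K` for `g`. -/
noncomputable def sepCard [PseudoMetricSpace X] (g : X → X) (K : Set X) (n : ℕ) (ε : ℝ) :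
    ℝ≥0∞ :=
  ⨆ (E : Finset X) (_ : ↑E ⊆ K ∧ IsSep g n ε ↑E), (E.card : ℝ≥0∞)

/-- Topological entropy of `g` relative to the set `K`:
`h_top(g,K) = lim_{ε→0} limsup_n (1/n) log E_K(n,ε)`; since the inner quantity is
monotone in `ε`, the limit as `ε → 0` is the supremum over `ε > 0`. -/
noncomputable def relEntropy [PseudoMetricSpace X] (g : X → X) (K : Set X) : EReal :=
  ⨆ (ε : ℝ) (_ : 0 < ε),
    Filter.limsup (fun n : ℕ => ENNReal.log (sepCard g K n ε) / (n : EReal)) atTop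

/-- Topological entropy of `g`. -/
noncomputable def topEntropy [PseudoMetricSpace X] (g : X → X) : EReal :=
  relEntropy g Set.univ

/-- A finite measurable partition of `X`. -/
def IsMPartition [MeasurableSpace X] (P : Finset (Set X)) : Prop :=
  (∀ A ∈ P, MeasurableSet A) ∧ ((P : Set (Set X)).PairwiseDisjoint id) ∧
    ⋃₀ (P : Set (Set X)) = Set.univ

/-- The entropy `H_μ(P ∨ g⁻¹P ∨ ⋯ ∨ g^{-(n-1)}P)` of the `n`-th dynamical refinement of the
partition `P`. -/
noncomputable def dynH [MeasurableSpace X] (μ : Measure X) (g : X → X) (P : Finset (Set X))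
    (n : ℕ) : ℝ :=
  ∑ A : Fin n → ↥P, Real.negMulLog (μ (⋂ i : Fin n, g^[i.1] ⁻¹' ((A i : Set X)))).toReal

/-- The measure-theoretic (Kolmogorov–Sinai) entropy `h_μ(g)`, using that for invariant `μ`
the limit `lim_n H_n/n` equals `inf_n H_n/n` by subadditivity. -/
noncomputable def mEntropy [MeasurableSpace X] (g : X → X) (μ : Measure X) : EReal :=
  ⨆ P : {P : Finset (Set X) // IsMPartition P},
    ⨅ n : ℕ, ((dynH μ g (P : Finset (Set X)) (n + 1) / (n + 1) : ℝ) : EReal)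

section Hyp

variable [MetricSpace X] [CompactSpace X] [MeasurableSpace X] [BorelSpace X]

/-- Hypothesis (H1): every class `[x] = h⁻¹(h x)` has zero relative topological entropy. -/
def HypH1 (g h : X → X) : Prop :=
  ∀ x : X, relEntropy g (h ⁻¹' {h x}) = 0

/-- Hypothesis (H2): every periodic class contains a `g`-periodic point whose `g`-period is
the `f`-period of `h x`. -/
def HypH2 (f g h : X → X) : Prop :=
  ∀ x : X, h x ∈ Function.periodicPts f →
    ∃ y : X, h y = h x ∧ Function.minimalPeriod g y = Function.minimalPeriod f (h x)

/-- Hypothesis (H3): the set of points whose class is trivial has full Bowen measure. -/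
def HypH3 (h : X → X) (μ : Measure X) : Prop :=
  μ {y : X | ∃ x : X, h ⁻¹' {y} = {x}} = 1

/-- `P` is an admissible choice of the sets `P̃er_n(g)`: `P n` consists of `g`-periodic points
of period `n` lying over `Per_n(f)`, and `h` maps `P n` bijectively onto `Per_n(f)`. -/
def IsPerSelection (f g h : X → X) (P : ℕ → Set X) : Prop :=
  ∀ n : ℕ, P n ⊆ perSet g n ∧ (∀ x ∈ P n, g x ∈ P n) ∧ Set.BijOn h (P n) (perSet f n)

end Hyp

end Samva

open Samva

namespace Samva

section SepLemmas

variable {X : Type*}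

/-- Any family of `(n,ε)`-separated finite sets has bounded cardinality. -/
lemma sep_card_bdd [PseudoMetricSpace X] [CompactSpace X] {g : X → X} (hg : Continuous g)
    (n : ℕ) {ε : ℝ} (hε : 0 < ε) :
    ∃ C : ℕ, ∀ E : Finset X, IsSep g n ε ↑E → E.card ≤ C := by
  classical
  obtain ⟨t, -, ht⟩ := (isCompact_univ (X := X)).elim_nhds_subcover
    (fun e => {x | ∀ j < n, dist (g^[j] x) (g^[j] e) < ε / 2}) (by
      intro e _
      have : IsOpen {x | ∀ j < n, dist (g^[j] x) (g^[j] e) < ε / 2} := by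
        have : {x | ∀ j < n, dist (g^[j] x) (g^[j] e) < ε / 2}
            = ⋂ j ∈ Finset.range n, {x | dist (g^[j] x) (g^[j] e) < ε / 2} := by
          ext x; simp
        rw [this]
        refine isOpen_biInter_finset fun j _ => ?_
        exact isOpen_lt ((hg.iterate j).dist continuous_const) continuous_const
      refine this.mem_nhds ?_
      intro j _
      simpa using hε)
  refine ⟨t.card, fun E hE => ?_⟩
  have hc : ∀ x : X, ∃ e ∈ t, ∀ j < n, dist (g^[j] x) (g^[j] e) < ε / 2 := by
    intro x
    have := ht (mem_univ x)
    simpa using this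
  choose c hct hc using hc
  refine Finset.card_le_card_of_injOn c (fun x _ => hct x) ?_
  intro x hx y hy hxy
  by_contra hne
  obtain ⟨j, hj, hd⟩ := hE hx hy hne
  have h1 := hc x j hj
  have h2 := hc y j hj
  rw [hxy] at h1
  have := dist_triangle_right (g^[j] x) (g^[j] y) (g^[j] (c y))
  linarith

/-- Maximal separated sets exist and are spanning. -/
lemma exists_max_sep [PseudoMetricSpace X] [CompactSpace X] {g : X → X} (hg : Continuous g)
    (K : Set X) (n : ℕ) {ε : ℝ} (hε : 0 < ε) :
    ∃ F : Finset X, ↑F ⊆ K ∧ IsSep g n ε ↑F ∧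
      ∀ x ∈ K, ∃ e ∈ F, ∀ j < n, dist (g^[j] x) (g^[j] e) ≤ ε := by
  classical
  obtain ⟨C, hC⟩ := sep_card_bdd hg n hε
  let p : ℕ → Prop := fun m => ∃ F : Finset X, (F : Set X) ⊆ K ∧ IsSep g n ε ↑F ∧ F.card = m
  have h0 : p 0 := ⟨∅, by simp, by simp [IsSep], rfl⟩
  have hp : p (Nat.findGreatest p C) := Nat.findGreatest_spec (Nat.zero_le C) h0
  obtain ⟨F, hFK, hF, hFc⟩ := hp
  refine ⟨F, hFK, hF, fun x hx => ?_⟩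
  by_contra hcon
  push Not at hcon
  have hxF : x ∉ F := by
    intro hxF
    obtain ⟨j, -, hj⟩ := hcon x hxF
    simp at hj
    linarith
  have hins : IsSep g n ε ↑(insert x F) := by
    unfold IsSep
    rw [Finset.coe_insert, Set.pairwise_insert]
    refine ⟨hF, fun y hy _ => ⟨hcon y hy, ?_⟩⟩
    obtain ⟨j, hj, hd⟩ := hcon y hy
    exact ⟨j, hj, by rwa [dist_comm]⟩
  have hpi : p (F.card + 1) := ⟨insert x F, by
    rw [Finset.coe_insert]; exact Set.insert_subset hx hFK, hins, by
    rw [Finset.card_insert_of_notMem hxF]⟩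
  have hle : F.card + 1 ≤ C := by
    have := hC _ hins
    rwa [Finset.card_insert_of_notMem hxF] at this
  have := Nat.le_findGreatest hle hpi
  omega

lemma card_le_sepCard [PseudoMetricSpace X] {g : X → X} {K : Set X} {n : ℕ} {ε : ℝ}
    {E : Finset X} (hK : ↑E ⊆ K) (hE : IsSep g n ε ↑E) : (E.card : ℝ≥0∞) ≤ sepCard g K n ε :=
  le_iSup₂_of_le (f := fun (E : Finset X) (_ : ↑E ⊆ K ∧ IsSep g n ε ↑E) => (E.card : ℝ≥0∞))
    E ⟨hK, hE⟩ le_rfl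

lemma log_ofReal_exp (a : ℝ) : ENNReal.log (ENNReal.ofReal (Real.exp a)) = (a : EReal) := by
  rw [ENNReal.log_ofReal_of_pos (Real.exp_pos a), Real.log_exp]

lemma nat_le_ofReal_iff {k : ℕ} {r : ℝ} (hr : 0 ≤ r) :
    (k : ℝ≥0∞) ≤ ENNReal.ofReal r ↔ (k : ℝ) ≤ r := by
  rw [← ENNReal.ofReal_natCast, ENNReal.ofReal_le_ofReal_iff hr]

/-- Upper bound criterion. -/
lemma limsup_sep_le [PseudoMetricSpace X] {g : X → X} {K : Set X} {ε a C : ℝ}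
    (H : ∀ᶠ n : ℕ in atTop, ∀ E : Finset X, ↑E ⊆ K → IsSep g n ε ↑E →
      (E.card : ℝ) ≤ Real.exp (a * n + C)) :
    Filter.limsup (fun n : ℕ => ENNReal.log (sepCard g K n ε) / (n : EReal)) atTop ≤ (a : EReal) := by
  have h1 : ∀ᶠ n : ℕ in atTop, ENNReal.log (sepCard g K n ε) / (n : EReal)
      ≤ ((a + C / n : ℝ) : EReal) := by
    filter_upwards [H, eventually_gt_atTop 0] with n hn hn0
    have hs : sepCard g K n ε ≤ ENNReal.ofReal (Real.exp (a * n + C)) := by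
      refine iSup₂_le fun E hE => ?_
      rw [nat_le_ofReal_iff (Real.exp_pos _).le]
      exact hn E hE.1 hE.2
    have hl : ENNReal.log (sepCard g K n ε) ≤ ((a * n + C : ℝ) : EReal) := by
      rw [← log_ofReal_exp]
      exact ENNReal.log_monotone hs
    have hn1 : (0 : ℝ) < n := by exact_mod_cast hn0
    have : ((a + C / n : ℝ) : EReal) = ((a * n + C : ℝ) : EReal) / (n : EReal) := by
      have : (n : EReal) = ((n : ℝ) : EReal) := by simp
      rw [this, ← EReal.coe_div]
      congr 1
      field_simp
    rw [this]
    exact EReal.div_le_div_right_of_nonneg (by positivity) hl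
  have h2 : Tendsto (fun n : ℕ => ((a + C / n : ℝ) : EReal)) atTop (𝓝 (a : EReal)) := by
    refine (continuous_coe_real_ereal.tendsto a).comp ?_
    have : Tendsto (fun n : ℕ => a + C / (n : ℝ)) atTop (𝓝 (a + 0)) :=
      tendsto_const_nhds.add (tendsto_const_div_atTop_nhds_zero_nat C)
    simpa using this
  calc _ ≤ Filter.limsup (fun n : ℕ => ((a + C / n : ℝ) : EReal)) atTop :=
        limsup_le_limsup h1
    _ = a := h2.limsup_eq

/-- Consequence of an upper bound. -/
lemma eventually_sep_le [PseudoMetricSpace X] {g : X → X} {K : Set X} {ε a : ℝ}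
    (H : Filter.limsup (fun n : ℕ => ENNReal.log (sepCard g K n ε) / (n : EReal)) atTop
      < (a : EReal)) :
    ∀ᶠ n : ℕ in atTop, ∀ E : Finset X, ↑E ⊆ K → IsSep g n ε ↑E →
      (E.card : ℝ) ≤ Real.exp (a * n) := by
  filter_upwards [eventually_lt_of_limsup_lt H, eventually_gt_atTop 0] with n hn hn0 E hEK hE
  have hn1 : (0 : ℝ) < n := by exact_mod_cast hn0
  have hnn : (n : EReal) = ((n : ℝ) : EReal) := by simp
  have h1 : ENNReal.log (sepCard g K n ε) ≤ ((a * n : ℝ) : EReal) := by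
    have h0 := hn.le
    rw [EReal.div_le_iff_le_mul (by rw [hnn]; exact_mod_cast hn1) (by rw [hnn]; exact EReal.coe_ne_top _)] at h0
    rw [EReal.coe_mul, mul_comm, ← hnn, mul_comm]
    first | exact h0 | (rw [mul_comm]; exact h0)
  rw [← log_ofReal_exp, ENNReal.log_le_log_iff] at h1
  rw [← nat_le_ofReal_iff (Real.exp_pos _).le]
  exact (card_le_sepCard hEK hE).trans h1

/-- The counting induction. -/
lemma card_le_of_cover [PseudoMetricSpace X] {Z : Type*} (g : X → X) (φ : Z → Z)
    (A : ℕ → Z → Set X)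
    (hA : ∀ n z t x, t ≤ n → x ∈ A n z → g^[t] x ∈ A (n - t) (φ^[t] z))
    {ρ τ : ℝ} (hτ : 0 ≤ τ) (M : ℕ)
    (hcov : ∀ z n, 1 ≤ n → ∃ t, 1 ≤ t ∧ t ≤ M ∧ ∃ F : Finset X,
      (F.card : ℝ) ≤ Real.exp (τ * t) ∧
      ∀ x ∈ A n z, ∃ e ∈ F, ∀ j < t, dist (g^[j] x) (g^[j] e) ≤ ρ / 2) :
    ∀ n z (E : Finset X), ↑E ⊆ A n z → IsSep g n ρ ↑E →
      (E.card : ℝ) ≤ Real.exp (τ * n + τ * M) := by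
  classical
  have hsmall : ∀ (E : Finset X), IsSep g 0 ρ ↑E → E.card ≤ 1 := by
    intro E hE
    rw [Finset.card_le_one]
    intro x hx y hy
    by_contra hne
    obtain ⟨j, hj, -⟩ := hE hx hy hne
    omega
  intro n
  induction n using Nat.strong_induction_on with
  | _ n ih =>
  intro z E hEA hE
  rcases Nat.eq_zero_or_pos n with rfl | hn
  · have h1 : (E.card : ℝ) ≤ 1 := by exact_mod_cast hsmall E hE
    refine h1.trans ?_
    rw [Real.one_le_exp_iff]
    positivity
  obtain ⟨t, ht1, htM, F, hF, hcF⟩ := hcov z n hn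
  have hclose : ∀ x ∈ E, ∀ y ∈ E, ∀ e, (∀ j < t, dist (g^[j] x) (g^[j] e) ≤ ρ / 2) →
      (∀ j < t, dist (g^[j] y) (g^[j] e) ≤ ρ / 2) → ∀ j < t, ¬ ρ < dist (g^[j] x) (g^[j] y) := by
    intro x _ y _ e h1 h2 j hj hlt
    have := dist_triangle_right (g^[j] x) (g^[j] y) (g^[j] e)
    have := h1 j hj
    have := h2 j hj
    linarith
  have hcF' : ∀ x, ∃ e, x ∈ E → e ∈ F ∧ ∀ j < t, dist (g^[j] x) (g^[j] e) ≤ ρ / 2 := by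
    intro x
    by_cases hx : x ∈ E
    · obtain ⟨e, he, h⟩ := hcF x (hEA hx)
      exact ⟨e, fun _ => ⟨he, h⟩⟩
    · exact ⟨x, fun h => absurd h hx⟩
  choose c hc using hcF'
  -- bound on each fibre
  have hfib : ∀ B : ℝ, 0 ≤ B → (∀ e ∈ F, ((E.filter (fun x => c x = e)).card : ℝ) ≤ B) →
      (E.card : ℝ) ≤ Real.exp (τ * t) * B := by
    intro B hB0 hB
    have h1 := Finset.card_eq_sum_card_fiberwise (f := c) (s := E) (t := F)
      (fun x hx => (hc x hx).1)
    have h2 : (E.card : ℝ) = ∑ e ∈ F, ((E.filter (fun x => c x = e)).card : ℝ) := by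
      exact_mod_cast h1
    rw [h2]
    calc _ ≤ ∑ e ∈ F, B := Finset.sum_le_sum hB
      _ = F.card * B := by simp
      _ ≤ _ := by
        exact mul_le_mul_of_nonneg_right hF hB0
  rcases le_or_gt n t with hnt | hnt
  · have h1 := hfib 1 zero_le_one (by
      intro e _
      have : (E.filter (fun x => c x = e)).card ≤ 1 := by
        rw [Finset.card_le_one]
        intro x hx y hy
        rw [Finset.mem_filter] at hx hy
        by_contra hne
        obtain ⟨j, hj, hd⟩ := hE hx.1 hy.1 hne
        refine hclose x hx.1 y hy.1 e ?_ ?_ j (by omega) hd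
        · have := (hc x hx.1).2; rwa [hx.2] at this
        · have := (hc y hy.1).2; rwa [hy.2] at this
      exact_mod_cast this)
    refine h1.trans ?_
    rw [mul_one, Real.exp_le_exp]
    have : (t : ℝ) ≤ M := by exact_mod_cast htM
    have := mul_le_mul_of_nonneg_left this hτ
    have : 0 ≤ τ * n := by positivity
    linarith
  · have h1 := hfib (Real.exp (τ * (n - t : ℕ) + τ * M)) (Real.exp_pos _).le (by
      intro e _
      set D := E.filter (fun x => c x = e) with hD
      have hsepD : ∀ x ∈ D, ∀ y ∈ D, x ≠ y → ∃ j < n - t,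
          ρ < dist (g^[j] (g^[t] x)) (g^[j] (g^[t] y)) := by
        intro x hx y hy hne
        rw [hD, Finset.mem_filter] at hx hy
        obtain ⟨j, hj, hd⟩ := hE hx.1 hy.1 hne
        have hjt : t ≤ j := by
          by_contra hlt
          refine hclose x hx.1 y hy.1 e ?_ ?_ j (by omega) hd
          · have := (hc x hx.1).2; rwa [hx.2] at this
          · have := (hc y hy.1).2; rwa [hy.2] at this
        refine ⟨j - t, by omega, ?_⟩
        rw [← Function.iterate_add_apply, ← Function.iterate_add_apply, Nat.sub_add_cancel hjt]
        exact hd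
      have hinj : Set.InjOn (g^[t]) (D : Set X) := by
        intro x hx y hy hxy
        by_contra hne
        obtain ⟨j, hj, hd⟩ := hsepD x hx y hy hne
        rw [hxy] at hd
        have hρ : ρ < 0 := by simpa using hd
        obtain ⟨e', he'⟩ := hcF x (hEA (Finset.mem_filter.1 hx).1)
        have := he'.2 0 (by omega)
        have h0 : (0 : ℝ) ≤ dist (g^[0] x) (g^[0] e') := dist_nonneg
        linarith
      rw [← Finset.card_image_of_injOn hinj]
      refine ih (n - t) (by omega) (φ^[t] z) _ ?_ ?_
      · intro y hy
        rw [Finset.coe_image] at hy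
        obtain ⟨x, hx, rfl⟩ := hy
        exact hA n z t x hnt.le (hEA (Finset.mem_filter.1 hx).1)
      · intro y hy y' hy' hne
        rw [Finset.coe_image] at hy hy'
        obtain ⟨x, hx, rfl⟩ := hy
        obtain ⟨x', hx', rfl⟩ := hy'
        exact hsepD x hx x' hx' (fun h => hne (by rw [h])))
    refine h1.trans ?_
    rw [← Real.exp_add, Real.exp_le_exp, Nat.cast_sub hnt.le]
    linarith

end SepLemmas

end Samva

namespace Samva

section TopEnt

lemma semi_iter {X : Type*} {f g h : X → X} (hsemi : ∀ x : X, f (h x) = h (g x)) (n : ℕ) (x : X) :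
    f^[n] (h x) = h (g^[n] x) := by
  induction n generalizing x with
  | zero => rfl
  | succ n ih => rw [Function.iterate_succ_apply, hsemi, ih, Function.iterate_succ_apply]

variable {X : Type*} [MetricSpace X] [CompactSpace X]

/-- Supermultiplicative lower bound for the number of separated points. -/
lemma exists_sep_card_ge [Nonempty X] {f : X → X} (hf : Continuous f) {ε a : ℝ} (hε : 0 < ε)
    (ha : (a : EReal) < Filter.limsup
      (fun n : ℕ => ENNReal.log (sepCard f univ n (2 * ε)) / (n : EReal)) atTop)
    (n : ℕ) : ∃ E : Finset X, IsSep f n ε ↑E ∧ Real.exp (a * n) ≤ E.card := by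
  rcases Nat.eq_zero_or_pos n with rfl | hn
  · obtain ⟨x⟩ := ‹Nonempty X›
    exact ⟨{x}, by simp [IsSep], by simp⟩
  by_cases ha0 : a < 0
  · obtain ⟨x⟩ := ‹Nonempty X›
    refine ⟨{x}, by simp [IsSep], ?_⟩
    simp only [Finset.card_singleton, Nat.cast_one, Real.exp_le_one_iff]
    exact mul_nonpos_of_nonpos_of_nonneg ha0.le (Nat.cast_nonneg n)
  push Not at ha0
  by_contra hcon
  push Not at hcon
  obtain ⟨F, -, hF, hFs⟩ := exists_max_sep hf univ n hε
  refine absurd ha (not_lt.2 ?_)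
  refine limsup_sep_le (C := a * n) (Eventually.of_forall fun m E _ hE => ?_)
  refine card_le_of_cover f (id : Unit → Unit) (fun _ _ => univ) (fun _ _ _ _ _ _ => mem_univ _)
    ha0 n ?_ m () E (subset_univ _) hE
  intro _ _ _
  refine ⟨n, hn, le_rfl, F, (hcon F hF).le, fun x hx => ?_⟩
  obtain ⟨e, he, h⟩ := hFs x hx
  exact ⟨e, he, fun j hj => (h j hj).trans (by linarith)⟩

lemma exists_unif {h : X → X} (hcont : Continuous h) {ε : ℝ} (hε : 0 < ε) :
    ∃ δ > 0, ∀ x y, dist x y ≤ δ → dist (h x) (h y) ≤ ε := by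
  have hu := CompactSpace.uniformContinuous_of_continuous hcont
  rw [Metric.uniformContinuous_iff] at hu
  obtain ⟨δ, hδ, H⟩ := hu ε hε
  refine ⟨δ / 2, by linarith, fun x y hxy => (H ?_).le⟩
  linarith

lemma topEntropy_factor_le {f g h : X → X} (hcont : Continuous h)
    (hsurj : Function.Surjective h) (hsemi : ∀ x : X, f (h x) = h (g x)) :
    topEntropy f ≤ topEntropy g := by
  classical
  refine iSup₂_le fun ε hε => ?_
  obtain ⟨δ, hδ, H⟩ := exists_unif hcont hε
  refine le_iSup₂_of_le δ hδ ?_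
  refine limsup_le_limsup (Eventually.of_forall fun n => ?_)
  refine EReal.div_le_div_right_of_nonneg (by positivity) (ENNReal.log_monotone ?_)
  refine iSup₂_le fun E hE => ?_
  obtain ⟨s, hs⟩ := hsurj.hasRightInverse
  rw [← Finset.card_image_of_injective E hs.injective]
  refine card_le_sepCard (subset_univ _) ?_
  intro y hy y' hy' hne
  rw [Finset.coe_image] at hy hy'
  obtain ⟨x, hx, rfl⟩ := hy
  obtain ⟨x', hx', rfl⟩ := hy'
  obtain ⟨j, hj, hd⟩ := hE.2 hx hx' (fun h => hne (by rw [h]))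
  refine ⟨j, hj, ?_⟩
  by_contra hle
  have := H _ _ (not_lt.1 hle)
  rw [← semi_iter hsemi, ← semi_iter hsemi, hs, hs] at this
  linarith

/-- Bowen's inequality, in the case of fibres of zero entropy. -/
lemma topEntropy_le_of_fibers {f g h : X → X} (hf : Continuous f) (hg : Continuous g)
    (hcont : Continuous h)
    (hsurj : Function.Surjective h) (hsemi : ∀ x : X, f (h x) = h (g x))
    (H1 : HypH1 g h) : topEntropy g ≤ topEntropy f := by
  classical
  refine iSup₂_le fun ε hε => ?_
  refine EReal.le_of_forall_lt_iff_le.1 fun b hb => ?_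
  -- pick a real number between
  obtain ⟨a, hfa, hab⟩ := EReal.lt_iff_exists_real_btwn.1 hb
  have hab' : a < b := by exact_mod_cast hab
  set τ := b - a with hτdef
  have hτ : 0 < τ := sub_pos.2 hab'
  have hε4 : 0 < ε / 4 := by linarith
  -- local data
  have hloc : ∀ y : X, ∃ (t : ℕ) (F : Finset X) (W : Set X), 1 ≤ t ∧ IsOpen W ∧ y ∈ W ∧
      (F.card : ℝ) ≤ Real.exp (τ * t) ∧
      ∀ x, h x ∈ W → ∃ e ∈ F, ∀ j < t, dist (g^[j] x) (g^[j] e) ≤ ε / 2 := by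
    intro y
    obtain ⟨x0, rfl⟩ := hsurj y
    have hlim : Filter.limsup (fun n : ℕ => ENNReal.log (sepCard g (h ⁻¹' {h x0}) n (ε / 4))
        / (n : EReal)) atTop < (τ : EReal) := by
      have h0 : Filter.limsup (fun n : ℕ => ENNReal.log (sepCard g (h ⁻¹' {h x0}) n (ε / 4))
        / (n : EReal)) atTop ≤ 0 := by
        rw [← H1 x0]
        exact le_iSup₂_of_le (f := fun (ε : ℝ) (_ : 0 < ε) => Filter.limsup (fun n : ℕ =>
          ENNReal.log (sepCard g (h ⁻¹' {h x0}) n ε) / (n : EReal)) atTop) (ε / 4) hε4 le_rfl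
      exact h0.trans_lt (by exact_mod_cast hτ)
    obtain ⟨t, ht, ht1⟩ := ((eventually_sep_le hlim).and (eventually_ge_atTop 1)).exists
    obtain ⟨F, hFK, hF, hFs⟩ := exists_max_sep hg (h ⁻¹' {h x0}) t hε4
    let U : Set X := ⋃ e ∈ F, ⋂ j ∈ Finset.range t, {x | dist (g^[j] x) (g^[j] e) < ε / 2}
    have hU : IsOpen U := by
      refine isOpen_biUnion fun e _ => isOpen_biInter_finset fun j _ => ?_
      exact isOpen_lt ((hg.iterate j).dist continuous_const) continuous_const
    have hKU : h ⁻¹' {h x0} ⊆ U := by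
      intro x hx
      obtain ⟨e, he, hd⟩ := hFs x hx
      simp only [U, mem_iUnion, mem_iInter]
      exact ⟨e, he, fun j hj => (hd j (Finset.mem_range.1 hj)).trans_lt (by linarith)⟩
    refine ⟨t, F, (h '' Uᶜ)ᶜ, ht1, ?_, ?_, ht F hFK hF, ?_⟩
    · exact (hcont.isClosedMap _ hU.isClosed_compl).isOpen_compl
    · rintro ⟨x, hx, hxx⟩
      exact hx (hKU hxx)
    · intro x hx
      have hxU : x ∈ U := by
        by_contra hxU
        exact hx ⟨x, hxU, rfl⟩
      simp only [U, mem_iUnion, mem_iInter] at hxU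
      obtain ⟨e, he, hd⟩ := hxU
      exact ⟨e, he, fun j hj => (hd j (Finset.mem_range.2 hj)).le⟩
  choose t F W ht1 hWo hyW hFc hFs using hloc
  obtain ⟨s, -, hs⟩ := (isCompact_univ (X := X)).elim_nhds_subcover W
    (fun y _ => (hWo y).mem_nhds (hyW y))
  obtain ⟨δ, hδ, hleb⟩ := lebesgue_number_lemma_of_metric (c := fun y : s => W y)
    (isCompact_univ (X := X)) (fun y => hWo y)
    (fun y hy => by simpa using hs hy)
  let M := s.sup t
  have hδ2 : 0 < δ / 2 := by linarith
  have hfa' : Filter.limsup (fun n : ℕ => ENNReal.log (sepCard f univ n (δ / 2))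
        / (n : EReal)) atTop < (a : EReal) :=
    lt_of_le_of_lt (le_iSup₂_of_le (f := fun (ε : ℝ) (_ : 0 < ε) => Filter.limsup (fun n : ℕ =>
          ENNReal.log (sepCard f univ n ε) / (n : EReal)) atTop) (δ / 2) hδ2 le_rfl) hfa
  refine limsup_sep_le (C := τ * M) ?_
  filter_upwards [eventually_sep_le hfa'] with n hn E _ hE
  obtain ⟨G, -, hG, hGs⟩ := exists_max_sep hf univ n hδ2
  have hGc := hn G (subset_univ _) hG
  let A : ℕ → X → Set X := fun n z => {x | ∀ j < n, dist (f^[j] (h x)) (f^[j] z) ≤ δ / 2}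
  have key := card_le_of_cover (ρ := ε) g f A (by
      intro n z t x htn hx j hj
      have := hx (j + t) (by omega)
      rw [← semi_iter hsemi, ← Function.iterate_add_apply, ← Function.iterate_add_apply]
      exact this) hτ.le M (by
      intro z n hn
      obtain ⟨y, hy⟩ := hleb z (mem_univ z)
      refine ⟨t y, ht1 y, Finset.le_sup (f := t) y.2, F y, hFc y, fun x hx => hFs y x (hy ?_)⟩
      have := hx 0 hn
      simp only [Function.iterate_zero, id_eq] at this
      rw [Metric.mem_ball]
      linarith)
  choose c hcG hc using fun x : X => hGs (h x) (mem_univ _)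
  have h1 := Finset.card_eq_sum_card_fiberwise (f := c) (s := E) (t := G) (fun x _ => hcG x)
  have h2 : (E.card : ℝ) = ∑ e ∈ G, ((E.filter (fun x => c x = e)).card : ℝ) := by
    exact_mod_cast h1
  rw [h2]
  calc _ ≤ ∑ e ∈ G, Real.exp (τ * n + τ * M) := by
        refine Finset.sum_le_sum fun e _ => key n e _ ?_ ?_
        · intro x hx
          have hx := (Finset.mem_filter.1 hx).2
          intro j hj
          rw [← hx]
          exact hc x j hj
        · exact hE.mono (fun x hx => (Finset.mem_filter.1 hx).1)
    _ = G.card * Real.exp (τ * n + τ * M) := by simp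
    _ ≤ Real.exp (a * n) * Real.exp (τ * n + τ * M) :=
        mul_le_mul_of_nonneg_right hGc (Real.exp_pos _).le
    _ = _ := by
      rw [← Real.exp_add, hτdef]
      congr 1
      ring

end TopEnt

end Samva

namespace Samva

section MeasEnt

/-- Gibbs' inequality. -/
lemma gibbs {ι : Type*} [Fintype ι] (p q : ι → ℝ) (hp : ∀ i, 0 ≤ p i) (hq : ∀ i, 0 ≤ q i)
    (hpq : ∀ i, 0 < p i → 0 < q i) (hsum : ∑ i, q i ≤ ∑ i, p i) :
    ∑ i, Real.negMulLog (p i) ≤ ∑ i, p i * (-Real.log (q i)) := by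
  have key : ∀ i, Real.negMulLog (p i) - p i * (-Real.log (q i)) ≤ q i - p i := by
    intro i
    rcases (hp i).eq_or_lt with h0 | h0
    · rw [← h0]; simpa using hq i
    · have hqi := hpq i h0
      have h1 := Real.log_le_sub_one_of_pos (div_pos hqi h0)
      rw [Real.log_div hqi.ne' h0.ne'] at h1
      have h2 := mul_le_mul_of_nonneg_left h1 h0.le
      have h3 : p i * (q i / p i - 1) = q i - p i := by field_simp
      rw [Real.negMulLog]
      linarith
  have := Finset.sum_le_sum (fun i (_ : i ∈ Finset.univ) => key i)
  rw [Finset.sum_sub_distrib, Finset.sum_sub_distrib] at this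
  linarith

variable {X : Type*}

/-- Cells of the dynamical refinement. -/
def cell (g : X → X) (P : Finset (Set X)) {n : ℕ} (A : Fin n → ↥P) : Set X :=
  ⋂ i : Fin n, g^[i.1] ⁻¹' ((A i : Set X))

lemma mem_cell {g : X → X} {P : Finset (Set X)} {n : ℕ} {A : Fin n → ↥P} {x : X} :
    x ∈ cell g P A ↔ ∀ i : Fin n, g^[i.1] x ∈ (A i : Set X) := by
  simp [cell]

lemma cell_append {g : X → X} {P : Finset (Set X)} {m n : ℕ} (A : Fin m → ↥P) (B : Fin n → ↥P) :
    cell g P (Fin.append A B) = cell g P A ∩ g^[m] ⁻¹' (cell g P B) := by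
  ext x
  simp only [mem_cell, mem_inter_iff, mem_preimage]
  constructor
  · intro h
    refine ⟨fun i => ?_, fun i => ?_⟩
    · simpa using h (Fin.castAdd n i)
    · have := h (Fin.natAdd m i)
      rw [Fin.append_right] at this
      rw [← Function.iterate_add_apply, add_comm]
      simpa using this
  · rintro ⟨h1, h2⟩ i
    refine Fin.addCases (fun i => ?_) (fun i => ?_) i
    · simpa using h1 i
    · rw [Fin.append_right]
      have := h2 i
      rw [← Function.iterate_add_apply, add_comm] at this
      simpa using this

variable [MeasurableSpace X]

lemma IsMPartition.eq_of_mem {P : Finset (Set X)} (hP : IsMPartition P) {A B : Set X}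
    (hA : A ∈ P) (hB : B ∈ P) {x : X} (hxA : x ∈ A) (hxB : x ∈ B) : A = B := by
  by_contra hne
  exact Set.disjoint_left.1 (hP.2.1 hA hB hne) hxA hxB

lemma IsMPartition.exists_mem {P : Finset (Set X)} (hP : IsMPartition P) (x : X) :
    ∃ A : ↥P, x ∈ (A : Set X) := by
  have : x ∈ ⋃₀ (P : Set (Set X)) := by rw [hP.2.2]; trivial
  obtain ⟨A, hA, hx⟩ := this
  exact ⟨⟨A, hA⟩, hx⟩

lemma cell_disjoint {g : X → X} {P : Finset (Set X)} (hP : IsMPartition P) {n : ℕ} :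
    Pairwise (Function.onFun Disjoint (fun A : Fin n → ↥P => cell g P A)) := by
  intro A B hne
  rw [Function.onFun, Set.disjoint_left]
  intro x hA hB
  rw [mem_cell] at hA hB
  apply hne
  funext i
  exact Subtype.ext (hP.eq_of_mem (A i).2 (B i).2 (hA i) (hB i))

lemma cell_iUnion {g : X → X} {P : Finset (Set X)} (hP : IsMPartition P) {n : ℕ} :
    (⋃ A : Fin n → ↥P, cell g P A) = univ := by
  rw [eq_univ_iff_forall]
  intro x
  choose A hA using fun i : Fin n => hP.exists_mem (g^[i.1] x)
  exact mem_iUnion.2 ⟨A, mem_cell.2 hA⟩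

lemma cell_meas {g : X → X} (hg : Measurable g) {P : Finset (Set X)} (hP : IsMPartition P) {n : ℕ}
    (A : Fin n → ↥P) : MeasurableSet (cell g P A) :=
  MeasurableSet.iInter fun i => hg.iterate _ (hP.1 _ (A i).2)

lemma sum_inter_cell {g : X → X} (hg : Measurable g) {P : Finset (Set X)} (hP : IsMPartition P)
    (n : ℕ) (μ : Measure X) [IsFiniteMeasure μ] {S : Set X} (hS : MeasurableSet S) :
    ∑ A : Fin n → ↥P, μ.real (S ∩ cell g P A) = μ.real S := by
  have h1 : S = ⋃ A ∈ (Finset.univ : Finset (Fin n → ↥P)), (S ∩ cell g P A) := by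
    simp only [Finset.mem_univ, iUnion_true]
    rw [← inter_iUnion, cell_iUnion hP, inter_univ]
  conv_rhs => rw [h1]
  rw [measureReal_biUnion_finset]
  · intro A _ B _ hne
    exact (cell_disjoint hP hne).mono inter_subset_right inter_subset_right
  · intro A _
    exact hS.inter (cell_meas hg hP A)

lemma sum_cell {g : X → X} (hg : Measurable g) {P : Finset (Set X)} (hP : IsMPartition P)
    (n : ℕ) (μ : Measure X) [IsProbabilityMeasure μ] :
    ∑ A : Fin n → ↥P, μ.real (cell g P A) = 1 := by
  have := sum_inter_cell hg hP n μ MeasurableSet.univ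
  simpa using this

lemma dynH_eq (μ : Measure X) (g : X → X) (P : Finset (Set X)) (n : ℕ) :
    dynH μ g P n = ∑ A : Fin n → ↥P, Real.negMulLog (μ.real (cell g P A)) := rfl

lemma dynH_nonneg (μ : Measure X) [IsProbabilityMeasure μ] (g : X → X) (P : Finset (Set X)) (n : ℕ) :
    0 ≤ dynH μ g P n := by
  rw [dynH_eq]
  exact Finset.sum_nonneg fun A _ => Real.negMulLog_nonneg measureReal_nonneg measureReal_le_one

lemma dynH_add {μ : Measure X} [IsProbabilityMeasure μ] {g : X → X} (hg : MeasurePreserving g μ μ)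
    {P : Finset (Set X)} (hP : IsMPartition P) (m n : ℕ) :
    dynH μ g P (m + n) ≤ dynH μ g P m + dynH μ g P n := by
  have hgm := hg.measurable
  rw [dynH_eq μ g P (m + n), ← (Fin.appendEquiv (α := ↥P) m n).sum_comp]
  set p : (Fin m → ↥P) × (Fin n → ↥P) → ℝ := fun AB => μ.real (cell g P (Fin.append AB.1 AB.2))
    with hp
  set p1 : (Fin m → ↥P) → ℝ := fun A => μ.real (cell g P A) with hp1
  set p2 : (Fin n → ↥P) → ℝ := fun B => μ.real (cell g P B) with hp2
  have hpre : ∀ B, μ.real (g^[m] ⁻¹' (cell g P B)) = p2 B := fun B =>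
    (hg.iterate m).measureReal_preimage (cell_meas hgm hP B).nullMeasurableSet
  have hle1 : ∀ AB, p AB ≤ p1 AB.1 := by
    intro AB
    simp only [hp, hp1, cell_append]
    exact measureReal_mono inter_subset_left
  have hle2 : ∀ AB, p AB ≤ p2 AB.2 := by
    intro AB
    rw [← hpre]
    simp only [hp, cell_append]
    exact measureReal_mono inter_subset_right
  have hm1 : ∀ A, ∑ B, p (A, B) = p1 A := by
    intro A
    have hmeas : MeasurableSet (cell g P A) := cell_meas hgm hP A
    have h1 : cell g P A = ⋃ B ∈ (Finset.univ : Finset (Fin n → ↥P)),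
        (cell g P A ∩ g^[m] ⁻¹' (cell g P B)) := by
      simp only [Finset.mem_univ, iUnion_true]
      rw [← inter_iUnion, ← preimage_iUnion, cell_iUnion hP, preimage_univ, inter_univ]
    simp only [hp, hp1, cell_append]
    conv_rhs => rw [h1]
    rw [measureReal_biUnion_finset]
    · intro B _ B' _ hne
      exact ((cell_disjoint hP hne).preimage _).mono inter_subset_right inter_subset_right
    · intro B _
      exact hmeas.inter (hgm.iterate m (cell_meas hgm hP B))
  have hm2 : ∀ B, ∑ A, p (A, B) = p2 B := by
    intro B
    rw [← hpre, ← sum_inter_cell hgm hP m μ (hgm.iterate m (cell_meas hgm hP B))]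
    refine Finset.sum_congr rfl fun A _ => ?_
    simp only [hp, cell_append]
    rw [inter_comm]
  have hG := gibbs p (fun AB => p1 AB.1 * p2 AB.2) (fun _ => measureReal_nonneg)
    (fun _ => mul_nonneg measureReal_nonneg measureReal_nonneg)
    (fun AB h => mul_pos (h.trans_le (hle1 AB)) (h.trans_le (hle2 AB))) (by
      rw [Fintype.sum_prod_type, Fintype.sum_prod_type]
      simp only [hm1]
      simp only [← Finset.mul_sum]
      have : ∑ B, p2 B = 1 := sum_cell hgm hP n μ
      simp [this])
  refine hG.trans (le_of_eq ?_)
  have h3 : ∀ AB, p AB * (-Real.log (p1 AB.1 * p2 AB.2))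
      = p AB * (-Real.log (p1 AB.1)) + p AB * (-Real.log (p2 AB.2)) := by
    intro AB
    have hnn : 0 ≤ p AB := measureReal_nonneg
    rcases hnn.eq_or_lt with h0 | h0
    · rw [← h0]; simp
    · rw [Real.log_mul (h0.trans_le (hle1 AB)).ne' (h0.trans_le (hle2 AB)).ne']
      ring
  refine (Finset.sum_congr rfl fun AB _ => h3 AB).trans ?_
  rw [Finset.sum_add_distrib]
  congr 1
  · rw [Fintype.sum_prod_type, dynH_eq]
    refine Finset.sum_congr rfl fun A _ => ?_
    simp only [← Finset.sum_mul, hm1]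
    simp [Real.negMulLog, hp1]
  · rw [Fintype.sum_prod_type_right, dynH_eq]
    refine Finset.sum_congr rfl fun B _ => ?_
    simp only [← Finset.sum_mul, hm2]
    simp [Real.negMulLog, hp2]

lemma dynH_le_const {μ : Measure X} [IsProbabilityMeasure μ] {g : X → X}
    {P : Finset (Set X)} (n : ℕ) : dynH μ g P n ≤ (P.card : ℝ) ^ n := by
  rw [dynH_eq]
  calc _ ≤ ∑ A : Fin n → ↥P, (1 : ℝ) := by
        refine Finset.sum_le_sum fun A _ => ?_
        have h0 : (0 : ℝ) ≤ μ.real (cell g P A) := measureReal_nonneg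
        have := Real.negMulLog_le_one_sub_self h0
        linarith
    _ = _ := by simp

lemma dynH_le_div {μ : Measure X} [IsProbabilityMeasure μ] {g : X → X}
    (hg : MeasurePreserving g μ μ)
    {P : Finset (Set X)} (hP : IsMPartition P) (hPc : 1 ≤ P.card) {n : ℕ} (hn : 0 < n) (m : ℕ) :
    dynH μ g P m ≤ (m : ℝ) / n * dynH μ g P n + (P.card : ℝ) ^ n := by
  have hmul : ∀ k, dynH μ g P (k * n + m % n) ≤ k * dynH μ g P n + (P.card : ℝ) ^ n := by
    intro k
    induction k with
    | zero =>
      simp only [zero_mul, zero_add, Nat.cast_zero]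
      refine (dynH_le_const _).trans ?_
      exact pow_le_pow_right₀ (by exact_mod_cast hPc) (Nat.mod_lt _ hn).le
    | succ k ih =>
      have h1 := dynH_add hg hP n (k * n + m % n)
      have h2 : n + (k * n + m % n) = (k + 1) * n + m % n := by ring
      rw [h2] at h1
      push_cast
      linarith
  have h1 := hmul (m / n)
  rw [Nat.div_add_mod'] at h1
  refine h1.trans ?_
  have := Nat.cast_div_le (α := ℝ) (m := m) (n := n)
  have := mul_le_mul_of_nonneg_right this (dynH_nonneg μ g P n)
  linarith

end MeasEnt

end Samva

namespace Samva

section UpperBound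

variable {X : Type*} [MetricSpace X] [CompactSpace X] [MeasurableSpace X] [BorelSpace X]

/-- Closed approximations of a partition, uniformly separated. -/
lemma exists_closed_approx {P : Finset (Set X)} (hP : IsMPartition P) (ν : Measure X)
    [IsProbabilityMeasure ν] {η : ℝ} (hη : 0 < η) :
    ∃ B : Set X → Set X, (∀ A ∈ P, B A ⊆ A) ∧ (∀ A ∈ P, IsClosed (B A)) ∧
      ν.real (⋃ A ∈ P, B A)ᶜ ≤ η ∧
      ∃ δ > 0, ∀ A ∈ P, ∀ A' ∈ P, ∀ x ∈ B A, ∀ y ∈ B A', dist x y ≤ δ → A = A' := by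
  classical
  have hη' : ENNReal.ofReal (η / (P.card + 1)) ≠ 0 := by
    have : 0 < η / (P.card + 1) := by positivity
    simpa using this
  have h1 : ∀ A : Set X, ∃ B : Set X, A ∈ P → B ⊆ A ∧ IsClosed B ∧
      ν (A \ B) < ENNReal.ofReal (η / (P.card + 1)) := by
    intro A
    by_cases hA : A ∈ P
    · obtain ⟨F, hFA, hFc, hF⟩ := (hP.1 A hA).exists_isClosed_sdiff_lt (measure_ne_top ν A) hη'
      exact ⟨F, fun _ => ⟨hFA, hFc, hF⟩⟩
    · exact ⟨∅, fun h => absurd h hA⟩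
  choose B hB using h1
  refine ⟨B, fun A hA => (hB A hA).1, fun A hA => (hB A hA).2.1, ?_, ?_⟩
  · have hsub : (⋃ A ∈ P, B A)ᶜ ⊆ ⋃ A ∈ P, (A \ B A) := by
      intro x hx
      obtain ⟨A, hA⟩ := hP.exists_mem x
      simp only [mem_compl_iff, mem_iUnion, not_exists] at hx
      simp only [mem_iUnion]
      exact ⟨A, A.2, hA, hx A A.2⟩
    calc ν.real (⋃ A ∈ P, B A)ᶜ ≤ ν.real (⋃ A ∈ P, (A \ B A)) := measureReal_mono hsub (measure_ne_top ν _)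
      _ ≤ ∑ A ∈ P, ν.real (A \ B A) := measureReal_biUnion_finset_le _ _
      _ ≤ ∑ A ∈ P, η / (P.card + 1) := by
        refine Finset.sum_le_sum fun A hA => ?_
        exact ENNReal.toReal_le_of_le_ofReal (by positivity) (hB A hA).2.2.le
      _ = P.card * (η / (P.card + 1)) := by simp
      _ ≤ η := by
        rw [mul_div_assoc', div_le_iff₀ (by positivity)]
        nlinarith
  · have h2 : ∀ q : ↥P × ↥P, ∃ δ : ℝ, 0 < δ ∧ ∀ x ∈ B q.1, ∀ y ∈ B q.2, dist x y ≤ δ →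
        q.1 = q.2 := by
      rintro ⟨A, A'⟩
      by_cases hne : A = A'
      · exact ⟨1, one_pos, fun _ _ _ _ _ => hne⟩
      · have hd : Disjoint (B A) (B A') :=
          (hP.2.1 A.2 A'.2 (fun h => hne (Subtype.ext h))).mono (hB A A.2).1 (hB A' A'.2).1
        obtain ⟨r, hr, H⟩ := Metric.exists_pos_forall_lt_edist (hB A A.2).2.1.isCompact
          (hB A' A'.2).2.1 hd
        refine ⟨r, hr, fun x hx y hy hxy => ?_⟩
        have := H x hx y hy
        rw [edist_nndist, ENNReal.coe_lt_coe] at this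
        exact absurd hxy (not_le.2 this)
    choose δ hδ H using h2
    have h3 : ∃ δ0 > 0, ∀ q, δ0 ≤ δ q := by
      rcases isEmpty_or_nonempty (↥P × ↥P) with he | he
      · exact ⟨1, one_pos, fun q => he.elim q⟩
      · obtain ⟨q, hq⟩ := Finite.exists_min δ
        exact ⟨δ q, hδ q, hq⟩
    obtain ⟨δ0, hδ0, hm⟩ := h3
    refine ⟨δ0, hδ0, fun A hA A' hA' x hx y hy hxy => ?_⟩
    have := H (⟨A, hA⟩, ⟨A', hA'⟩) x hx y hy (hxy.trans (hm _))
    exact congrArg Subtype.val this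

set_option maxHeartbeats 1000000 in
/-- Key counting estimate. -/
lemma dynH_le_span {P : Finset (Set X)} (hP : IsMPartition P) {ν : Measure X}
    [IsProbabilityMeasure ν] {g : X → X} (hgν : MeasurePreserving g ν ν)
    {B : Set X → Set X} (hBA : ∀ A ∈ P, B A ⊆ A) (hBc : ∀ A ∈ P, IsClosed (B A))
    {η δ t : ℝ} (hη : ν.real (⋃ A ∈ P, B A)ᶜ ≤ η)
    (hδ : ∀ A ∈ P, ∀ A' ∈ P, ∀ x ∈ B A, ∀ y ∈ B A', dist x y ≤ δ → A = A')
    (ht0 : 0 < t) (ht1 : t < 1) {n : ℕ} {E : Finset X}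
    (hE : ∀ x, ∃ e ∈ E, ∀ j < n, dist (g^[j] x) (g^[j] e) ≤ δ / 2) :
    dynH ν g P n ≤ Real.log E.card + n * (η * (Real.log P.card - Real.log t)
      - Real.log (1 - t)) := by
  classical
  have hgm := hgν.measurable
  obtain ⟨x0⟩ : Nonempty X := nonempty_of_isProbabilityMeasure ν
  have hEpos : 0 < E.card := by
    obtain ⟨e, he, -⟩ := hE x0
    exact Finset.card_pos.2 ⟨e, he⟩
  have hPpos : 0 < P.card := by
    obtain ⟨A, -⟩ := hP.exists_mem x0
    exact Finset.card_pos.2 ⟨A, A.2⟩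
  have hN : (0 : ℝ) < E.card := by exact_mod_cast hEpos
  have hk : (1 : ℝ) ≤ P.card := by exact_mod_cast hPpos
  have hk0 : (0 : ℝ) < P.card := by linarith
  set B0 : Set X := (⋃ A ∈ P, B A)ᶜ with hB0
  have hB0m : MeasurableSet B0 :=
    (isClosed_biUnion_finset hBc).measurableSet.compl
  let S : X → Finset (Fin n) := fun x => Finset.univ.filter (fun i => g^[i.1] x ∈ B0)
  let w : Finset (Fin n) → ℝ := fun s => t ^ s.card * (1 - t) ^ (n - s.card)
  have hw : ∀ s, 0 < w s := fun s => mul_pos (pow_pos ht0 _) (pow_pos (by linarith) _)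
  have hwsum : ∑ s, w s = 1 := by
    have := Fintype.sum_pow_mul_eq_add_pow (Fin n) t (1 - t)
    simpa [w] using this
  let R : X → Finset (Fin n) → (Fin n → ↥P) → Prop := fun e s A =>
    ∃ x, (∀ j < n, dist (g^[j] x) (g^[j] e) ≤ δ / 2) ∧ S x = s ∧ x ∈ cell g P A
  let c : Finset (Fin n) → ℝ := fun s => (E.card : ℝ)⁻¹ * w s * ((P.card : ℝ) ^ s.card)⁻¹
  have hc : ∀ s, 0 < c s := fun s => by
    have := hw s
    positivity
  let q : (Fin n → ↥P) → ℝ := fun A => ∑ e ∈ E, ∑ s, if R e s A then c s else 0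
  have hq0 : ∀ A, 0 ≤ q A := fun A =>
    Finset.sum_nonneg fun e _ => Finset.sum_nonneg fun s _ => by
      split_ifs
      · exact (hc s).le
      · exact le_rfl
  -- lower bound for q
  have hqx : ∀ A x, x ∈ cell g P A → c (S x) ≤ q A := by
    intro A x hx
    obtain ⟨e, he, hd⟩ := hE x
    have hR : R e (S x) A := ⟨x, hd, rfl, hx⟩
    have hnn : ∀ e s, 0 ≤ (if R e s A then c s else 0) := fun e s => by
      split_ifs
      · exact (hc s).le
      · exact le_rfl
    calc c (S x) = if R e (S x) A then c (S x) else 0 := by rw [if_pos hR]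
      _ ≤ ∑ s, if R e s A then c s else 0 :=
        Finset.single_le_sum (f := fun s => if R e s A then c s else 0)
          (fun s _ => hnn e s) (Finset.mem_univ _)
      _ ≤ q A := Finset.single_le_sum (f := fun e => ∑ s, if R e s A then c s else 0)
          (fun e _ => Finset.sum_nonneg fun s _ => hnn e s) he
  -- number of names
  have hcount : ∀ e s, ((Finset.univ.filter (fun A => R e s A)).card : ℝ) ≤ (P.card : ℝ) ^ s.card := by
    intro e s
    have : (Finset.univ.filter (fun A => R e s A)).card ≤ Fintype.card (↥s → ↥P) := by
      rw [← Finset.card_univ]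
      refine Finset.card_le_card_of_injOn (fun A i => A i) (fun _ _ => Finset.mem_univ _) ?_
      intro A hA A' hA' hAA
      obtain ⟨x, hxd, hxs, hxA⟩ := (Finset.mem_filter.1 hA).2
      obtain ⟨y, hyd, hys, hyA⟩ := (Finset.mem_filter.1 hA').2
      rw [mem_cell] at hxA hyA
      funext i
      by_cases hi : i ∈ s
      · exact congrFun hAA ⟨i, hi⟩
      · have hgood : ∀ (z : X) (D : ↥P), S z = s → g^[i.1] z ∈ (D : Set X) →
            g^[i.1] z ∈ B D := by
          intro z D hz hzD
          rw [← hz] at hi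
          simp only [S, Finset.mem_filter, Finset.mem_univ, true_and, hB0, mem_compl_iff,
            not_not, mem_iUnion] at hi
          obtain ⟨D', hD', hm⟩ := hi
          rwa [hP.eq_of_mem D.2 hD' hzD (hBA D' hD' hm)]
        have h1 := hgood x (A i) hxs (hxA i)
        have h2 := hgood y (A' i) hys (hyA i)
        refine Subtype.ext (hδ _ (A i).2 _ (A' i).2 _ h1 _ h2 ?_)
        have := dist_triangle_right (g^[i.1] x) (g^[i.1] y) (g^[i.1] e)
        have := hxd i i.2
        have := hyd i i.2
        linarith
    have h2 : Fintype.card (↥s → ↥P) = P.card ^ s.card := by simp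
    rw [h2] at this
    exact_mod_cast this
  have hqsum : ∑ A, q A ≤ 1 := by
    calc ∑ A, q A = ∑ e ∈ E, ∑ s, ∑ A, if R e s A then c s else 0 := by
          simp only [q]
          rw [Finset.sum_comm]
          refine Finset.sum_congr rfl fun e _ => ?_
          rw [Finset.sum_comm]
      _ ≤ ∑ e ∈ E, ∑ s, (E.card : ℝ)⁻¹ * w s := by
          refine Finset.sum_le_sum fun e _ => Finset.sum_le_sum fun s _ => ?_
          rw [← Finset.sum_filter, Finset.sum_const, nsmul_eq_mul]
          calc _ ≤ (P.card : ℝ) ^ s.card * c s := mul_le_mul_of_nonneg_right (hcount e s) (hc s).le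
            _ = _ := by
              simp only [c]
              field_simp
      _ = 1 := by
          simp only [← Finset.mul_sum, hwsum, Finset.sum_const, nsmul_eq_mul, mul_one]
          field_simp
  have hG := gibbs (fun A : Fin n → ↥P => ν.real (cell g P A)) q (fun _ => measureReal_nonneg)
    hq0 (fun A hA => by
      have : (cell g P A).Nonempty := by
        by_contra hne
        rw [not_nonempty_iff_eq_empty] at hne
        simp [hne] at hA
      obtain ⟨x, hx⟩ := this
      exact (hc _).trans_le (hqx A x hx)) (by
      rw [sum_cell hgm hP n ν]; exact hqsum)
  rw [dynH_eq]
  refine hG.trans ?_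
  -- integrate
  set L : ℝ := Real.log P.card - Real.log t with hL
  have hL0 : 0 ≤ L := by
    have := Real.log_nonneg hk
    have := Real.log_neg ht0 ht1
    linarith
  let W : X → ℝ := fun x => (Real.log E.card - n * Real.log (1 - t)) +
    ∑ i : Fin n, (g^[i.1] ⁻¹' B0).indicator (fun _ => L) x
  have hWx : ∀ A x, x ∈ cell g P A → -Real.log (q A) ≤ W x := by
    intro A x hx
    have h1 := Real.log_le_log (hc _) (hqx A x hx)
    have h2 : Real.log (c (S x)) = -Real.log E.card + ((S x).card * Real.log t +
        ((n - (S x).card : ℕ) : ℝ) * Real.log (1 - t)) - (S x).card * Real.log P.card := by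
      have hw' := (hw (S x)).ne'
      simp only [c]
      rw [Real.log_mul (mul_ne_zero (inv_ne_zero hN.ne') hw') (by positivity),
        Real.log_mul (inv_ne_zero hN.ne') hw', Real.log_inv, Real.log_inv, Real.log_pow]
      simp only [w]
      rw [Real.log_mul (pow_pos ht0 _).ne' (pow_pos (by linarith) _).ne', Real.log_pow,
        Real.log_pow]
      ring
    have h3 : ∑ i : Fin n, (g^[i.1] ⁻¹' B0).indicator (fun _ => L) x = (S x).card * L := by
      simp only [Set.indicator_apply, mem_preimage]
      rw [← Finset.sum_filter, Finset.sum_const, nsmul_eq_mul]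
    have h4 : ((n - (S x).card : ℕ) : ℝ) ≤ n := by exact_mod_cast Nat.sub_le _ _
    have h5 : Real.log (1 - t) ≤ 0 := Real.log_nonpos (by linarith) (by linarith)
    have h6 := mul_le_mul_of_nonpos_right h4 h5
    simp only [W]
    rw [h3, hL]
    nlinarith
  have hWi : Integrable W ν := by
    refine (integrable_const _).add (integrable_finsetSum _ fun i _ => ?_)
    exact (integrable_const L).indicator (hgm.iterate _ hB0m)
  have hint : ∫ x, W x ∂ν ≤ (Real.log E.card - n * Real.log (1 - t)) + n * (η * L) := by
    have hind : ∀ i : Fin n, Integrable ((g^[i.1] ⁻¹' B0).indicator (fun _ => L)) ν := fun i =>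
      (integrable_const L).indicator (hgm.iterate _ hB0m)
    simp only [W]
    rw [integral_add (integrable_const _) (integrable_finsetSum _ fun i _ => hind i),
      integral_finsetSum _ (fun i _ => hind i)]
    simp only [integral_const, probReal_univ, one_smul]
    have : ∀ i : Fin n, ∫ x, (g^[i.1] ⁻¹' B0).indicator (fun _ => L) x ∂ν ≤ η * L := by
      intro i
      rw [integral_indicator_const _ (hgm.iterate _ hB0m), smul_eq_mul,
        (hgν.iterate i.1).measureReal_preimage hB0m.nullMeasurableSet]
      exact mul_le_mul_of_nonneg_right hη hL0
    have := Finset.sum_le_sum (fun i (_ : i ∈ Finset.univ) => this i)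
    simp only [Finset.sum_const, Finset.card_univ, Fintype.card_fin, nsmul_eq_mul] at this
    linarith
  calc ∑ A, ν.real (cell g P A) * (-Real.log (q A))
      ≤ ∑ A : Fin n → ↥P, ∫ x in cell g P A, W x ∂ν := by
        refine Finset.sum_le_sum fun A _ => ?_
        have h1 : ν.real (cell g P A) * (-Real.log (q A))
            = ∫ x in cell g P A, (-Real.log (q A)) ∂ν := by
          rw [setIntegral_const, smul_eq_mul]
        rw [h1]
        exact setIntegral_mono_on (integrable_const _) hWi.integrableOn (cell_meas hgm hP A)
          (hWx A)
    _ = ∫ x, W x ∂ν := by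
        rw [← integral_iUnion_fintype (cell_meas hgm hP) (cell_disjoint hP)
          (fun A => hWi.integrableOn), cell_iUnion hP, setIntegral_univ]
    _ ≤ _ := hint.trans (le_of_eq (by ring))

/-- The easy half of the variational principle. -/
lemma mEntropy_le_topEntropy {ν : Measure X} [IsProbabilityMeasure ν] {g : X → X}
    (hg : Continuous g) (hgν : MeasurePreserving g ν ν) : mEntropy g ν ≤ topEntropy g := by
  refine iSup_le fun ⟨P, hP⟩ => ?_
  refine EReal.le_of_forall_lt_iff_le.1 fun b hb => ?_
  obtain ⟨a, hfa, hab⟩ := EReal.lt_iff_exists_real_btwn.1 hb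
  have hab' : a < b := by exact_mod_cast hab
  set τ := b - a with hτdef
  have hτ : 0 < τ := sub_pos.2 hab'
  obtain ⟨x0⟩ : Nonempty X := nonempty_of_isProbabilityMeasure ν
  have hPpos : 0 < P.card := by
    obtain ⟨A, -⟩ := hP.exists_mem x0
    exact Finset.card_pos.2 ⟨A, A.2⟩
  have hk : (1 : ℝ) ≤ P.card := by exact_mod_cast hPpos
  -- choose t
  obtain ⟨t, ht0, ht1, ht⟩ : ∃ t : ℝ, 0 < t ∧ t < 1 ∧ -Real.log (1 - t) ≤ τ / 2 := by
    refine ⟨1 - Real.exp (-(τ / 2)), ?_, ?_, ?_⟩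
    · have : Real.exp (-(τ / 2)) < 1 := Real.exp_lt_one_iff.2 (by linarith)
      linarith
    · have := Real.exp_pos (-(τ / 2))
      linarith
    · simp
  set L : ℝ := Real.log P.card - Real.log t with hL
  have hL0 : 0 < L := by
    have := Real.log_nonneg hk
    have := Real.log_neg ht0 ht1
    linarith
  obtain ⟨B, hBA, hBc, hη, δ, hδ0, hδ⟩ := exists_closed_approx hP ν (η := τ / 2 / L) (by positivity)
  have hδ2 : 0 < δ / 2 := by linarith
  have hfa' : Filter.limsup (fun n : ℕ => ENNReal.log (sepCard g univ n (δ / 2))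
        / (n : EReal)) atTop < (a : EReal) :=
    lt_of_le_of_lt (le_iSup₂_of_le (f := fun (ε : ℝ) (_ : 0 < ε) => Filter.limsup (fun n : ℕ =>
          ENNReal.log (sepCard g univ n ε) / (n : EReal)) atTop) (δ / 2) hδ2 le_rfl) hfa
  obtain ⟨n, hn, hn1⟩ := ((eventually_sep_le hfa').and (eventually_ge_atTop 1)).exists
  obtain ⟨E, -, hE, hEs⟩ := exists_max_sep hg univ n hδ2
  have hEc := hn E (subset_univ _) hE
  have key := dynH_le_span hP hgν hBA hBc hη hδ ht0 ht1 (n := n) (E := E)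
    (fun x => hEs x (mem_univ x))
  have hEpos : (0 : ℝ) < E.card := by
    obtain ⟨e, he, -⟩ := hEs x0 (mem_univ _)
    exact_mod_cast Finset.card_pos.2 ⟨e, he⟩
  have hlog : Real.log E.card ≤ a * n := by
    rw [← Real.log_exp (a * n)]
    exact Real.log_le_log hEpos hEc
  have hfin : dynH ν g P n ≤ b * n := by
    have h1 : τ / 2 / L * (Real.log P.card - Real.log t) = τ / 2 := by
      rw [← hL]; field_simp
    rw [h1] at key
    have h2 : (n : ℝ) * (τ / 2 - Real.log (1 - t)) ≤ n * τ :=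
      mul_le_mul_of_nonneg_left (by linarith) (Nat.cast_nonneg n)
    have h3 : b * n = a * n + n * τ := by rw [hτdef]; ring
    linarith
  obtain ⟨m, rfl⟩ : ∃ m, n = m + 1 := ⟨n - 1, by omega⟩
  refine iInf_le_of_le m ?_
  rw [EReal.coe_le_coe_iff, div_le_iff₀ (by positivity)]
  push_cast at hfin
  exact hfin

end UpperBound

end Samva

namespace Samva

section Periodic

variable {X : Type*} [MetricSpace X] [CompactSpace X]

lemma zIter_eq {X : Type*} [TopologicalSpace X] (f : X ≃ₜ X) (n : ℤ) (x : X) :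
    zIter f n x = ((f.toEquiv : Equiv.Perm X) ^ n) x := by
  cases n with
  | ofNat n =>
    have := Equiv.Perm.iterate_eq_pow (f.toEquiv : Equiv.Perm X) n
    simp only [zIter, Int.ofNat_eq_natCast, zpow_natCast]
    rw [← this]
    rfl
  | negSucc n =>
    have := Equiv.Perm.iterate_eq_pow ((f.toEquiv : Equiv.Perm X)⁻¹) (n + 1)
    simp only [zIter, zpow_negSucc]
    rw [← inv_pow, ← this]
    rfl

lemma zIter_natCast {X : Type*} [TopologicalSpace X] (f : X ≃ₜ X) (n : ℕ) (x : X) :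
    zIter f (n : ℤ) x = f^[n] x := rfl

lemma zIter_per {X : Type*} [TopologicalSpace X] (f : X ≃ₜ X) {m : ℕ} (hm : 0 < m) (n : ℤ) {x : X}
    (hx : x ∈ perSet f m) : zIter f n x = f^[(n % m).toNat] x := by
  have hnn : 0 ≤ n % m := Int.emod_nonneg _ (by exact_mod_cast hm.ne')
  rw [← zIter_natCast, Int.toNat_of_nonneg hnn, zIter_eq, zIter_eq]
  conv_lhs => rw [← Int.emod_add_mul_ediv n m, zpow_add, zpow_mul]
  have hfix : ((f.toEquiv : Equiv.Perm X) ^ (m : ℤ)) x = x := by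
    rw [← zIter_eq]
    exact hx
  rw [Equiv.Perm.mul_apply, Equiv.Perm.zpow_apply_eq_self_of_apply_eq_self hfix]

lemma perSet_sep {X : Type*} [PseudoMetricSpace X] {f : X ≃ₜ X} {α : ℝ} (hα : IsExpansiveWith f α)
    {m : ℕ} (hm : 0 < m) : IsSep f m α (perSet f m) := by
  intro x hx y hy hne
  by_contra hcon
  push Not at hcon
  refine hne (hα.2 x y fun n => ?_)
  rw [zIter_per f hm n hx, zIter_per f hm n hy]
  have hm' : (0 : ℤ) < m := by exact_mod_cast hm
  have h1 := Int.emod_nonneg n hm'.ne'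
  have h2 := Int.emod_lt_of_pos n hm'
  exact hcon _ (by omega)

lemma finite_of_sep {g : X → X} (hg : Continuous g) {n : ℕ} {ε : ℝ} (hε : 0 < ε) {s : Set X}
    (hs : IsSep g n ε s) : s.Finite := by
  by_contra hinf
  obtain ⟨C, hC⟩ := sep_card_bdd hg n hε
  obtain ⟨t, hts, htc⟩ := (show s.Infinite from hinf).exists_subset_card_eq (C + 1)
  have := hC t (Set.Pairwise.mono hts hs)
  omega

lemma card_le_per {f : X ≃ₜ X} (hspec : HasSpecification f) {ε : ℝ} (hε : 0 < ε) :
    ∃ M : ℕ, ∀ n m : ℕ, 1 ≤ n → n + M ≤ m → (perSet f m).Finite →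
      ∀ E : Finset X, IsSep f n ε ↑E → E.card ≤ (perSet f m).ncard := by
  obtain ⟨M, hM⟩ := hspec (ε / 2) (by linarith)
  refine ⟨M, fun n m hn hnm hfin E hE => ?_⟩
  have h1 : ∀ x : X, ∃ z ∈ perSet f m, ∀ j < n, dist (f^[j] z) (f^[j] x) ≤ ε / 2 := by
    intro x
    obtain ⟨z, hz, hzd⟩ := hM 0 (fun _ => x) (fun _ => 0) (fun _ => (n : ℤ) - 1)
      (fun _ => by omega) (fun i => i.elim0) (m : ℤ) (by omega)
    refine ⟨z, hz, fun j hj => ?_⟩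
    exact hzd 0 j (by omega) (by omega)
  choose z hz hd using h1
  rw [Set.ncard_eq_toFinset_card _ hfin]
  refine Finset.card_le_card_of_injOn z (fun x _ => by simpa using hz x) ?_
  intro x hx y hy hxy
  by_contra hne
  obtain ⟨j, hj, hlt⟩ := hE hx hy hne
  have h1 := hd x j hj
  have h2 := hd y j hj
  rw [hxy] at h1
  have := dist_triangle_left (f^[j] x) (f^[j] y) (f^[j] (z y))
  linarith

end Periodic

section Unif

variable {X : Type*} [MeasurableSpace X] [MeasurableSingletonClass X]

lemma unif_apply {s : Set X} (hs : s.Finite) (A : Set X) :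
    unifMeasure s A = (Measure.count s)⁻¹ * Measure.count (s ∩ A) :=
  ProbabilityTheory.cond_apply hs.measurableSet _ _

lemma unif_preserving {s : Set X} (hs : s.Finite) {g : X → X} (hg : Measurable g)
    (hinj : Function.Injective g) (hmap : ∀ x ∈ s, g x ∈ s) :
    MeasurePreserving g (unifMeasure s) (unifMeasure s) := by
  refine ⟨hg, Measure.ext fun A hA => ?_⟩
  rw [Measure.map_apply hg hA, unif_apply hs, unif_apply hs]
  congr 1
  have himg : g '' s = s := by
    refine Set.eq_of_subset_of_ncard_le (by rintro _ ⟨x, hx, rfl⟩; exact hmap x hx) ?_ hs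
    rw [Set.ncard_image_of_injective _ hinj]
  rw [← Measure.count_injective_image hinj, Set.image_inter_preimage, himg]

lemma unif_real_le {s : Set X} (hs : s.Finite) {A : Set X} (hA : (s ∩ A).Subsingleton) :
    (unifMeasure s).real A ≤ (s.ncard : ℝ)⁻¹ := by
  have h1 : Measure.count (s ∩ A) ≤ 1 := by
    rw [Measure.count_apply (hs.subset inter_subset_left).measurableSet]
    have := Set.encard_le_one_iff_subsingleton.2 hA
    exact_mod_cast this
  have h2 : Measure.count s = (s.ncard : ℝ≥0∞) := by
    rw [Measure.count_apply hs.measurableSet, ← hs.cast_ncard_eq]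
    simp
  have h3 : unifMeasure s A ≤ (s.ncard : ℝ≥0∞)⁻¹ := by
    rw [unif_apply hs, h2]
    calc _ ≤ (s.ncard : ℝ≥0∞)⁻¹ * 1 := by gcongr
      _ = _ := mul_one _
  rcases s.eq_empty_or_nonempty with rfl | hne
  · rw [measureReal_def, unif_apply hs]; simp
  have hpos : s.ncard ≠ 0 := by
    rw [Ne, Set.ncard_eq_zero hs]
    exact hne.ne_empty
  rw [measureReal_def]
  calc _ ≤ ((s.ncard : ℝ≥0∞)⁻¹).toReal :=
        ENNReal.toReal_mono (by simpa using hpos) h3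
    _ = _ := by simp

lemma log_card_le_dynH {s : Set X} (hs : s.Finite) (hne : s.Nonempty) {g : X → X}
    (hg : Measurable g) {Q : Finset (Set X)} (hQ : IsMPartition Q) {m : ℕ}
    (hcell : ∀ A : Fin m → ↥Q, (s ∩ cell g Q A).Subsingleton) :
    Real.log s.ncard ≤ dynH (unifMeasure s) g Q m := by
  have : IsProbabilityMeasure (unifMeasure s) :=
    ProbabilityTheory.isProbabilityMeasure_uniformOn hs hne
  have hsum := sum_cell hg hQ m (unifMeasure s)
  rw [dynH_eq]
  calc Real.log s.ncard = ∑ A : Fin m → ↥Q, (unifMeasure s).real (cell g Q A) * Real.log s.ncard := by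
        rw [← Finset.sum_mul, hsum, one_mul]
    _ ≤ _ := by
      refine Finset.sum_le_sum fun A _ => ?_
      have hle := unif_real_le hs (hcell A)
      rcases (measureReal_nonneg : 0 ≤ (unifMeasure s).real (cell g Q A)).eq_or_lt with h0 | h0
      · rw [← h0]; simp
      · have h1 := Real.log_le_log h0 hle
        rw [Real.log_inv] at h1
        rw [Real.negMulLog]
        nlinarith

end Unif

section Boundary

variable {X : Type*} [MetricSpace X] [CompactSpace X] [MeasurableSpace X] [BorelSpace X]

lemma null_frontier_inter {Y : Type*} [TopologicalSpace Y] [MeasurableSpace Y] {ν : Measure Y}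
    {A B : Set Y} (hA : ν (frontier A) = 0)
    (hB : ν (frontier B) = 0) : ν (frontier (A ∩ B)) = 0 := by
  refine measure_mono_null (frontier_inter_subset A B) (measure_union_null ?_ ?_)
  · exact measure_mono_null inter_subset_left hA
  · exact measure_mono_null inter_subset_right hB

lemma null_frontier_biInter {Y : Type*} [TopologicalSpace Y] [MeasurableSpace Y] {ν : Measure Y}
    {ι : Type*} (s : Finset ι) {A : ι → Set Y} (hA : ∀ i ∈ s, ν (frontier (A i)) = 0) :
    ν (frontier (⋂ i ∈ s, A i)) = 0 := by
  classical
  induction s using Finset.induction_on with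
  | empty => simp
  | insert i s _ ih =>
    rw [Finset.set_biInter_insert]
    exact null_frontier_inter (hA i (Finset.mem_insert_self _ _))
      (ih fun j hj => hA j (Finset.mem_insert_of_mem hj))

lemma exists_partition (ν : Measure X) [IsProbabilityMeasure ν] {δ : ℝ} (hδ : 0 < δ) :
    ∃ Q : Finset (Set X), IsMPartition Q ∧ (∀ A ∈ Q, ∀ x ∈ A, ∀ y ∈ A, dist x y ≤ δ) ∧
      ∀ A ∈ Q, ν (frontier A) = 0 := by
  classical
  have h1 : ∀ x : X, ∃ r : ℝ, 0 < r ∧ r < δ / 2 ∧ ν (frontier (Metric.ball x r)) = 0 := by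
    intro x
    obtain ⟨r, hr, h⟩ := exists_null_frontier_thickening ν {x} (show (0 : ℝ) < δ / 2 by linarith)
    rw [Metric.thickening_singleton] at h
    exact ⟨r, hr.1, hr.2, h⟩
  choose r hr0 hrδ hr using h1
  obtain ⟨s, -, hs⟩ := (isCompact_univ (X := X)).elim_nhds_subcover
    (fun x => Metric.ball x (r x)) (fun x _ => Metric.ball_mem_nhds x (hr0 x))
  let D : Finset X → Set X := fun T =>
    ⋂ e ∈ s, if e ∈ T then Metric.ball e (r e) else (Metric.ball e (r e))ᶜ
  have hD : ∀ T x, x ∈ D T ↔ ∀ e ∈ s, (x ∈ Metric.ball e (r e) ↔ e ∈ T) := by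
    intro T x
    simp only [D, mem_iInter]
    refine forall₂_congr fun e _ => ?_
    by_cases he : e ∈ T
    · simp [he]
    · simp [he]
  refine ⟨s.powerset.image D, ⟨?_, ?_, ?_⟩, ?_, ?_⟩
  · intro A hA
    obtain ⟨T, -, rfl⟩ := Finset.mem_image.1 hA
    refine Finset.measurableSet_biInter _ fun e _ => ?_
    split_ifs
    · exact measurableSet_ball
    · exact measurableSet_ball.compl
  · intro A hA A' hA' hne
    obtain ⟨T, hT, rfl⟩ := Finset.mem_image.1 (Finset.mem_coe.1 hA)
    obtain ⟨T', hT', rfl⟩ := Finset.mem_image.1 (Finset.mem_coe.1 hA')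
    rw [Finset.mem_powerset] at hT hT'
    simp only [Function.onFun, id]
    rw [Set.disjoint_left]
    intro x hx hx'
    apply hne
    congr 1
    rw [hD] at hx hx'
    ext e
    constructor
    · intro he
      exact (hx' e (hT he)).1 ((hx e (hT he)).2 he)
    · intro he
      exact (hx e (hT' he)).1 ((hx' e (hT' he)).2 he)
  · rw [eq_univ_iff_forall]
    intro x
    refine mem_sUnion.2 ⟨D (s.filter fun e => x ∈ Metric.ball e (r e)), ?_, ?_⟩
    · exact Finset.mem_coe.2 (Finset.mem_image_of_mem _ (Finset.mem_powerset.2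
        (Finset.filter_subset _ _)))
    · rw [hD]
      intro e he
      rw [Finset.mem_filter]
      exact ⟨fun h => ⟨he, h⟩, fun h => h.2⟩
  · intro A hA x hx y hy
    obtain ⟨T, -, rfl⟩ := Finset.mem_image.1 hA
    rw [hD] at hx hy
    have hxs := hs (mem_univ x)
    simp only [mem_iUnion] at hxs
    obtain ⟨e, he, hxe⟩ := hxs
    have hye := (hy e he).2 ((hx e he).1 hxe)
    rw [Metric.mem_ball] at hxe hye
    have := dist_triangle_right x y e
    have := hrδ e
    linarith
  · intro A hA
    obtain ⟨T, -, rfl⟩ := Finset.mem_image.1 hA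
    refine null_frontier_biInter s fun e _ => ?_
    split_ifs
    · exact hr e
    · rw [frontier_compl]; exact hr e

lemma null_frontier_cell {ν : Measure X} {g : X → X} (hg : Continuous g)
    (hgν : MeasurePreserving g ν ν) {Q : Finset (Set X)} (hQ : ∀ A ∈ Q, ν (frontier A) = 0)
    {n : ℕ} (A : Fin n → ↥Q) : ν (frontier (cell g Q A)) = 0 := by
  have h1 : cell g Q A = ⋂ i ∈ (Finset.univ : Finset (Fin n)), g^[i.1] ⁻¹' ((A i : Set X)) := by
    simp [cell]
  rw [h1]
  refine null_frontier_biInter _ fun i _ => ?_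
  refine measure_mono_null ((hg.iterate i.1).frontier_preimage_subset _) ?_
  rw [(hgν.iterate i.1).measure_preimage isClosed_frontier.measurableSet.nullMeasurableSet]
  exact hQ _ (A i).2

/-- The lower bound (Misiurewicz' argument). -/
lemma le_mEntropy {g : X → X} (hg : Continuous g) {ν : ProbabilityMeasure X}
    {νs : ℕ → ProbabilityMeasure X} (hlim : Tendsto νs atTop (𝓝 ν))
    (hgν : MeasurePreserving g (ν : Measure X) (ν : Measure X))
    (s : ℕ → Set X) (hs : ∀ k, (νs k : Measure X) = unifMeasure (s k))
    (hfin : ∀ k, (s k).Finite) (hne : ∀ k, (s k).Nonempty)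
    (hinv : ∀ k, MeasurePreserving g (νs k : Measure X) (νs k : Measure X))
    {m : ℕ → ℕ} (hm : Tendsto m atTop atTop) {δ : ℝ} (hδ : 0 < δ)
    (hsep : ∀ k, IsSep g (m k) δ (s k)) {a C : ℝ}
    (hcard : ∀ k, a * m k - C ≤ Real.log (s k).ncard) :
    (a : EReal) ≤ mEntropy g (ν : Measure X) := by
  obtain ⟨Q, hQ, hQδ, hQν⟩ := exists_partition (ν : Measure X) hδ
  refine le_iSup_of_le (⟨Q, hQ⟩ : {P : Finset (Set X) // IsMPartition P}) (le_iInf fun n => ?_)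
  obtain ⟨x0⟩ : Nonempty X := nonempty_of_isProbabilityMeasure (ν : Measure X)
  have hQpos : 1 ≤ Q.card := by
    obtain ⟨A, -⟩ := hQ.exists_mem x0
    exact Finset.card_pos.2 ⟨A, A.2⟩
  rw [EReal.coe_le_coe_iff]
  have hconv : Tendsto (fun k => dynH (νs k : Measure X) g Q (n + 1)) atTop
      (𝓝 (dynH (ν : Measure X) g Q (n + 1))) := by
    simp only [dynH_eq]
    refine tendsto_finsetSum _ fun A _ => ?_
    refine (Real.continuous_negMulLog.tendsto _).comp ?_
    have := ProbabilityMeasure.tendsto_measure_of_null_frontier_of_tendsto' hlim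
      (null_frontier_cell hg hgν hQν A)
    exact (ENNReal.tendsto_toReal (measure_ne_top _ _)).comp this
  have hconv2 : Tendsto (fun k => dynH (νs k : Measure X) g Q (n + 1) / (n + 1)
      + (C + (Q.card : ℝ) ^ (n + 1)) / (m k)) atTop
      (𝓝 (dynH (ν : Measure X) g Q (n + 1) / (n + 1) + 0)) :=
    (hconv.div_const _).add
      ((tendsto_const_div_atTop_nhds_zero_nat (C + (Q.card : ℝ) ^ (n + 1))).comp hm)
  rw [add_zero] at hconv2
  refine ge_of_tendsto hconv2 ?_
  filter_upwards [hm.eventually_gt_atTop 0] with k hk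
  have hk' : (0 : ℝ) < m k := by exact_mod_cast hk
  have h1 : Real.log (s k).ncard ≤ dynH (νs k : Measure X) g Q (m k) := by
    rw [hs k]
    refine log_card_le_dynH (hfin k) (hne k) hg.measurable hQ ?_
    intro A x hx y hy
    by_contra hxy
    obtain ⟨j, hj, hd⟩ := hsep k hx.1 hy.1 hxy
    have hxA := mem_cell.1 hx.2 ⟨j, hj⟩
    have hyA := mem_cell.1 hy.2 ⟨j, hj⟩
    have := hQδ _ (A ⟨j, hj⟩).2 _ hxA _ hyA
    exact absurd hd (not_lt.2 this)
  have h2 := dynH_le_div (hinv k) hQ hQpos (Nat.succ_pos n) (m k)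
  have h3 := hcard k
  have h4 : a * m k ≤ m k / ((n + 1 : ℕ) : ℝ) * dynH (νs k : Measure X) g Q (n + 1)
      + (C + (Q.card : ℝ) ^ (n + 1)) := by
    calc a * m k = (a * m k - C) + C := by ring
      _ ≤ (m k / ((n + 1 : ℕ) : ℝ) * dynH (νs k : Measure X) g Q (n + 1)
        + (Q.card : ℝ) ^ (n + 1)) + C := by
          gcongr
          exact h3.trans (h1.trans h2)
      _ = _ := by ring
  rw [← mul_le_mul_iff_left₀ hk']
  refine h4.trans (le_of_eq ?_)
  push_cast
  field_simp

end Boundary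

end Samva

/-- Under (H1), `h_top(g) = h_top(f)` and any weak* accumulation point `ν` of `(ν_n)` is a
measure of maximal entropy for `g`. -/
theorem accumulation_point_is_maximal
    {X : Type*} [MetricSpace X] [CompactSpace X] [MeasurableSpace X] [BorelSpace X]
    (f g : X ≃ₜ X) (h : X → X) (hcont : Continuous h) (hsurj : Function.Surjective h)
    (hsemi : ∀ x : X, f (h x) = h (g x))
    (hexp : IsExpansive f) (hspec : HasSpecification f)
    (μ : Measure X) (hμprob : IsProbabilityMeasure μ)
    (hμ : WeakLimit (perMeasure (⇑f)) μ)
    (H1 : HypH1 (⇑g) h) (H2 : HypH2 (⇑f) (⇑g) h)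
    (P : ℕ → Set X) (hP : IsPerSelection (⇑f) (⇑g) h P)
 :
    topEntropy (⇑g) = topEntropy (⇑f) ∧
    ∀ ν : Measure X, WeakClusterPt (fun n => unifMeasure (P n)) ν →
      mEntropy (⇑g) ν = topEntropy (⇑g) := by
  have htop : topEntropy (⇑g) = topEntropy (⇑f) :=
    le_antisymm (topEntropy_le_of_fibers f.continuous g.continuous hcont hsurj hsemi H1)
      (topEntropy_factor_le hcont hsurj hsemi)
  refine ⟨htop, ?_⟩
  rintro ν ⟨u, hu, hlim⟩
  have hX : Nonempty X := nonempty_of_isProbabilityMeasure μ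
  obtain ⟨α, hα⟩ := hexp
  obtain ⟨δ, hδ, hδh⟩ := exists_unif hcont hα.1
  -- basic facts on the periodic sets
  have hfinper : ∀ m : ℕ, 0 < m → (perSet f m).Finite := fun m hm =>
    finite_of_sep f.continuous hα.1 (perSet_sep hα hm)
  have hfinP : ∀ m : ℕ, 0 < m → (P m).Finite := fun m hm =>
    ((hP m).2.2.finite_iff_finite).2 (hfinper m hm)
  have hcardP : ∀ m : ℕ, (P m).ncard = (perSet f m).ncard := fun m => by
    rw [← (hP m).2.2.image_eq, (hP m).2.2.injOn.ncard_image]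
  have hsepP : ∀ m : ℕ, 0 < m → IsSep g m δ (P m) := by
    intro m hm x hx y hy hne
    obtain ⟨j, hj, hd⟩ := perSet_sep hα hm ((hP m).2.2.mapsTo hx) ((hP m).2.2.mapsTo hy)
      (fun he => hne ((hP m).2.2.injOn hx hy he))
    refine ⟨j, hj, ?_⟩
    by_contra hle
    have := hδh _ _ (not_lt.1 hle)
    rw [semi_iter hsemi, semi_iter hsemi] at hd
    linarith
  -- nonemptiness
  obtain ⟨M0, hM0⟩ := card_le_per hspec one_pos
  have hneP : ∀ m : ℕ, 1 + M0 ≤ m → (P m).Nonempty := by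
    intro m hm
    obtain ⟨x⟩ := hX
    have h1 := hM0 1 m le_rfl hm (hfinper m (by omega)) {x} (by simp [IsSep])
    rw [← hcardP] at h1
    refine Set.nonempty_of_ncard_ne_zero ?_
    simp at h1
    omega
  have hprobP : ∀ m : ℕ, 1 + M0 ≤ m → IsProbabilityMeasure (unifMeasure (P m)) := fun m hm =>
    ProbabilityTheory.isProbabilityMeasure_uniformOn (hfinP m (by omega)) (hneP m hm)
  have hinvP : ∀ m : ℕ, 0 < m → MeasurePreserving g (unifMeasure (P m)) (unifMeasure (P m)) :=
    fun m hm => unif_preserving (hfinP m hm) g.continuous.measurable g.injective (hP m).2.1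
  have hu' : Tendsto u atTop atTop := hu.tendsto_atTop
  -- ν is a probability measure
  have hνprob : IsProbabilityMeasure ν := by
    have h1 := hlim (ContinuousMap.const X 1)
    have h2 : Tendsto (fun n => ∫ x, (ContinuousMap.const X (1 : ℝ)) x
        ∂(((fun n => unifMeasure (P n)) ∘ u) n)) atTop (𝓝 1) := by
      refine tendsto_const_nhds.congr' ?_
      filter_upwards [hu'.eventually_ge_atTop (1 + M0)] with k hk
      have := hprobP (u k) hk
      simp
    have h3 := tendsto_nhds_unique h1 h2
    simp only [ContinuousMap.const_apply, integral_const, smul_eq_mul, mul_one] at h3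
    rw [measureReal_def, ENNReal.toReal_eq_one_iff] at h3
    exact ⟨h3⟩
  -- ν is invariant
  have hgν : MeasurePreserving g ν ν := by
    refine ⟨g.continuous.measurable, ?_⟩
    have : IsProbabilityMeasure (ν.map g) :=
      Measure.isProbabilityMeasure_map g.continuous.measurable.aemeasurable
    refine ext_of_forall_integral_eq_of_IsFiniteMeasure fun φ => ?_
    rw [integral_map g.continuous.measurable.aemeasurable
      φ.continuous.aestronglyMeasurable]
    have h1 := hlim φ.toContinuousMap
    have h2 := hlim (φ.toContinuousMap.comp ⟨g, g.continuous⟩)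
    refine tendsto_nhds_unique (h2.congr' ?_) h1
    filter_upwards [hu'.eventually_ge_atTop 1] with k hk
    have h3 := (hinvP (u k) hk).map_eq
    have h4 := integral_map (μ := unifMeasure (P (u k))) g.continuous.measurable.aemeasurable
      (f := φ) φ.continuous.aestronglyMeasurable
    rw [h3] at h4
    exact h4.symm
  refine le_antisymm (mEntropy_le_topEntropy g.continuous hgν) ?_
  refine EReal.ge_of_forall_gt_iff_ge.1 fun a ha => ?_
  rw [htop] at ha
  obtain ⟨ε, hε, haε⟩ : ∃ ε : ℝ, 0 < ε ∧ (a : EReal) < Filter.limsup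
      (fun n : ℕ => ENNReal.log (sepCard f univ n ε) / (n : EReal)) atTop := by
    unfold topEntropy relEntropy at ha
    simp only [lt_iSup_iff] at ha
    obtain ⟨ε, hε, h⟩ := ha
    exact ⟨ε, hε, h⟩
  have hε2 : 0 < ε / 2 := by linarith
  obtain ⟨M, hM⟩ := card_le_per hspec hε2
  have hcard : ∀ m : ℕ, 1 + M ≤ m → a * m - a * M ≤ Real.log (P m).ncard := by
    intro m hm
    obtain ⟨E, hE, hEc⟩ := exists_sep_card_ge f.continuous hε2
      (by rwa [mul_div_cancel₀ ε two_ne_zero]) (m - M)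
    have h1 := hM (m - M) m (by omega) (by omega) (hfinper m (by omega)) E hE
    rw [← hcardP] at h1
    have h2 : Real.exp (a * (m - M : ℕ)) ≤ (P m).ncard := hEc.trans (by exact_mod_cast h1)
    have h3 := Real.log_le_log (Real.exp_pos _) h2
    rw [Real.log_exp, Nat.cast_sub (by omega)] at h3
    linarith
  -- shift the sequence
  obtain ⟨K, hK⟩ := eventually_atTop.1 (hu'.eventually_ge_atTop (1 + M0 + M))
  have hK' : ∀ k, 1 + M0 + M ≤ u (k + K) := fun k => hK _ (by omega)
  let νs : ℕ → ProbabilityMeasure X := fun k =>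
    ⟨unifMeasure (P (u (k + K))), hprobP _ (by have := hK' k; omega)⟩
  let ν' : ProbabilityMeasure X := ⟨ν, hνprob⟩
  have hlim' : Tendsto νs atTop (𝓝 ν') := by
    refine ProbabilityMeasure.tendsto_iff_forall_integral_tendsto.2 fun φ => ?_
    exact (tendsto_add_atTop_iff_nat K).2 (hlim φ.toContinuousMap)
  exact le_mEntropy (ν := ν') g.continuous hlim' hgν (fun k => P (u (k + K))) (fun k => rfl)
    (fun k => hfinP _ (by have := hK' k; omega)) (fun k => hneP _ (by have := hK' k; omega))
    (fun k => hinvP _ (by have := hK' k; omega)) (m := fun k => u (k + K))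
    (hu'.comp (tendsto_add_atTop_nat K)) hδ
    (fun k => hsepP _ (by have := hK' k; omega))
    (fun k => hcard _ (by have := hK' k; omega))
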